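/- Composition rule: let E be infinitely differentiable on a neighborhood of [−1,1]. Then for every n ≥ 2, every l ∈ ℤ, and every integer s ≥ 0, the series ∑_{t≥0} φ_{n−1}(s,t)·Ψ^n_{r_n−l}(t) converges and its sum equals Ψ^{n−1}_{r_{n−1}−l}(s). -/

import Mathlib

open MeasureTheory Real

/-- Chebyshev polynomials of the second (`α = 1/2`) and third (`α = -1/2`) kind. -/
noncomputable def chebJ (α : ℝ) : ℕ → ℝ → ℝ
  | 0, _ => 1
  | 1, x => if α = 1 / 2 then 2 * x else 2 * x - 1
  | n + 2, x => 2 * x * chebJ α (n + 1) x - chebJ α n x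

/-- The normalized inner product `⟨f,g⟩_α`. -/
noncomputable def innerJ (α : ℝ) (f g : ℝ → ℝ) : ℝ :=
  (2 : ℝ) ^ (α + 1 / 2) / Real.pi *
    ∫ x in (-1 : ℝ)..1, f x * g x * (1 - x) ^ α * (1 + x) ^ ((1 : ℝ) / 2)

/-- `r_n = ⌊(n+1)/2⌋`. -/
def rr (n : ℕ) : ℕ := (n + 1) / 2

/-- `α_n = 1/2` if `n` even, `-1/2` if `n` odd. -/
noncomputable def alph (n : ℕ) : ℝ := if Even n then 1 / 2 else -(1 / 2)

/-- `φ_n(s,t) = 2·1_{s<t}` if `n` even and `1_{s≤t}` if `n` odd. -/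
def phiStep (n : ℕ) (s t : ℕ) : ℝ :=
  if Even n then (if s < t then 2 else 0) else (if s ≤ t then 1 else 0)

/-- The `m`-th Taylor remainder of `E` about `1` (equal to `E` for `m ≤ 0`). -/
noncomputable def taylorRem (E : ℝ → ℝ) (m : ℤ) (x : ℝ) : ℝ :=
  E x - ∑ k ∈ Finset.range m.toNat,
    iteratedDeriv k E 1 / (Nat.factorial k) * (x - 1) ^ k

/-- The function `x ↦ (x−1)^{−m}·R^E_m(x)`, with the continuous extension
at `x = 1` (value `E^{(m)}(1)/m!`) when `m ≥ 1`. -/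
noncomputable def powRem (E : ℝ → ℝ) (m : ℤ) (x : ℝ) : ℝ :=
  if 0 < m then
    (if x = 1 then iteratedDeriv m.toNat E 1 / (Nat.factorial m.toNat)
     else taylorRem E m x / (x - 1) ^ m.toNat)
  else (x - 1) ^ (-m).toNat * E x

/-- `Ψ^n_{r_n−l}(s) := ⟨J_{s,α_n}, (x−1)^{r_n−l}·R^E_{l−r_n}⟩_{α_n}`. -/
noncomputable def PsiFn (E : ℝ → ℝ) (n : ℕ) (l : ℤ) (s : ℕ) : ℝ :=
  innerJ (alph n) (chebJ (alph n) s) (powRem E (l - (rr n : ℤ)))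

open Set Filter Topology

section Chebyshev

lemma chebJ_half_cos_mul_sin (t : ℕ) (θ : ℝ) :
    chebJ (1 / 2) t (cos θ) * sin θ = sin ((t + 1) * θ) := by
  induction t using Nat.twoStepInduction with
  | zero => simp [chebJ]
  | one =>
    have h : ((1 : ℕ) + 1 : ℝ) * θ = 2 * θ := by push_cast; ring
    rw [h, sin_two_mul, chebJ, if_pos rfl]
    ring
  | more k h₀ h₁ =>
    have h₂ : ((k + 2 : ℕ) + 1 : ℝ) * θ = ((k + 1 : ℕ) + 1 : ℝ) * θ + θ := by push_cast; ring
    have h₃ : ((k : ℝ) + 1) * θ = ((k + 1 : ℕ) + 1 : ℝ) * θ - θ := by push_cast; ring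
    rw [h₃, sin_sub] at h₀
    rw [h₂, sin_add, chebJ]
    linear_combination 2 * cos θ * h₁ - h₀

lemma chebJ_neg_half_cos_mul_cos (t : ℕ) (θ : ℝ) :
    chebJ (-(1 / 2)) t (cos θ) * cos (θ / 2) = cos ((t + 1 / 2) * θ) := by
  induction t using Nat.twoStepInduction with
  | zero => simp [chebJ]; ring_nf
  | one =>
    have h : ((1 : ℕ) + 1 / 2 : ℝ) * θ = 3 * (θ / 2) := by push_cast; ring
    have hc : cos θ = 2 * cos (θ / 2) ^ 2 - 1 := by rw [← cos_two_mul]; ring_nf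
    rw [h, cos_three_mul, chebJ, if_neg (by norm_num), hc]
    ring
  | more k h₀ h₁ =>
    have h₂ : ((k + 2 : ℕ) + 1 / 2 : ℝ) * θ = ((k + 1 : ℕ) + 1 / 2 : ℝ) * θ + θ := by
      push_cast; ring
    have h₃ : ((k : ℝ) + 1 / 2) * θ = ((k + 1 : ℕ) + 1 / 2 : ℝ) * θ - θ := by push_cast; ring
    rw [h₃, cos_sub] at h₀
    rw [h₂, cos_add, chebJ]
    linear_combination 2 * cos θ * h₁ - h₀

lemma integral_neg_one_one_eq_integral_cos (g : ℝ → ℝ) :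
    ∫ x in (-1 : ℝ)..1, g x = ∫ θ in (0 : ℝ)..π, sin θ * g (cos θ) := by
  have himage : cos '' Icc 0 π = Icc (-1) 1 := bijOn_cos.image_eq
  rw [intervalIntegral.integral_of_le (by norm_num), intervalIntegral.integral_of_le pi_pos.le,
    ← integral_Icc_eq_integral_Ioc, ← integral_Icc_eq_integral_Ioc, ← himage,
    integral_image_eq_integral_abs_deriv_smul measurableSet_Icc
      (fun x _ => (hasDerivAt_cos x).hasDerivWithinAt) injOn_cos]
  refine setIntegral_congr_fun measurableSet_Icc fun θ hθ => ?_
  simp only [abs_neg, smul_eq_mul, abs_of_nonneg (sin_nonneg_of_mem_Icc hθ)]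

lemma innerJ_half_chebJ (t : ℕ) (f : ℝ → ℝ) :
    innerJ (1 / 2) (chebJ (1 / 2) t) f =
      1 / π * ∫ θ in (0 : ℝ)..π, (cos (t * θ) - cos ((t + 2) * θ)) * f (cos θ) := by
  rw [innerJ, integral_neg_one_one_eq_integral_cos, show (1 / 2 + 1 / 2 : ℝ) = 1 by norm_num,
    rpow_one, show (2 / π : ℝ) = 1 / π * 2 by ring, mul_assoc,
    ← intervalIntegral.integral_const_mul 2]
  congr 1
  refine intervalIntegral.integral_congr fun θ hθ => ?_
  rw [uIcc_of_le pi_pos.le] at hθ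
  have hweight : (1 - cos θ) ^ (1 / 2 : ℝ) * (1 + cos θ) ^ (1 / 2 : ℝ) = sin θ := by
    rw [← mul_rpow (by linarith [cos_le_one θ]) (by linarith [neg_one_le_cos θ]),
      show (1 - cos θ) * (1 + cos θ) = sin θ ^ 2 by rw [sin_sq]; ring, ← sqrt_eq_rpow,
      sqrt_sq (sin_nonneg_of_mem_Icc hθ)]
  have h₁ : (t : ℝ) * θ = (t + 1) * θ - θ := by ring
  have h₂ : ((t : ℝ) + 2) * θ = (t + 1) * θ + θ := by ring
  have h := chebJ_half_cos_mul_sin t θ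
  rw [h₁, h₂, cos_sub, cos_add, ← h]
  linear_combination 2 * sin θ * chebJ (1 / 2) t (cos θ) * f (cos θ) * hweight

lemma innerJ_neg_half_chebJ (t : ℕ) (f : ℝ → ℝ) :
    innerJ (-(1 / 2)) (chebJ (-(1 / 2)) t) f =
      1 / π * ∫ θ in (0 : ℝ)..π, (cos (t * θ) + cos ((t + 1) * θ)) * f (cos θ) := by
  rw [innerJ, integral_neg_one_one_eq_integral_cos, show (-(1 / 2) + 1 / 2 : ℝ) = 0 by norm_num,
    rpow_zero]
  congr 1
  refine intervalIntegral.integral_congr_uIoo fun θ hθ => ?_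
  rw [uIoo_of_le pi_pos.le] at hθ
  have hs : 0 < sin (θ / 2) := sin_pos_of_pos_of_lt_pi (by linarith [hθ.1]) (by linarith [hθ.2, pi_pos])
  have hc : 0 < cos (θ / 2) :=
    cos_pos_of_mem_Ioo ⟨by linarith [hθ.1, pi_pos], by linarith [hθ.2]⟩
  have hsin : sin θ = 2 * sin (θ / 2) * cos (θ / 2) := by rw [← sin_two_mul]; ring_nf
  have hcos : cos θ = 2 * cos (θ / 2) ^ 2 - 1 := by rw [← cos_two_mul]; ring_nf
  have hweight : sin θ * ((1 - cos θ) ^ (-(1 / 2) : ℝ) * (1 + cos θ) ^ (1 / 2 : ℝ)) =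
      2 * cos (θ / 2) ^ 2 := by
    have h₁ : 1 - cos θ = 2 * sin (θ / 2) ^ 2 := by rw [hcos, sin_sq]; ring
    have h₂ : 1 + cos θ = 2 * cos (θ / 2) ^ 2 := by rw [hcos]; ring
    rw [h₁, h₂, rpow_neg (by positivity), ← sqrt_eq_rpow, ← sqrt_eq_rpow, sqrt_mul (by norm_num),
      sqrt_mul (by norm_num), sqrt_sq hs.le, sqrt_sq hc.le, hsin]
    field_simp
  have h₁ : (t : ℝ) * θ = (t + 1 / 2) * θ - θ / 2 := by ring
  have h₂ : ((t : ℝ) + 1) * θ = (t + 1 / 2) * θ + θ / 2 := by ring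
  have h := chebJ_neg_half_cos_mul_cos t θ
  rw [h₁, h₂, cos_sub, cos_add, ← h]
  linear_combination chebJ (-(1 / 2)) t (cos θ) * f (cos θ) * hweight

end Chebyshev

section CosineCoefficients

/-- The cosine coefficient `(1/π) ∫₀^π cos(kθ) f(cos θ) dθ`. -/
noncomputable def cosCoeff (f : ℝ → ℝ) (k : ℕ) : ℝ :=
  1 / π * ∫ θ in (0 : ℝ)..π, cos (k * θ) * f (cos θ)

lemma intervalIntegrable_cos_mul_comp_cos {G : ℝ → ℝ} (hG : Continuous G) (k : ℕ) :
    IntervalIntegrable (fun θ => cos (k * θ) * G (cos θ)) volume 0 π :=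
  Continuous.intervalIntegrable (by fun_prop) _ _

lemma cos_mem_Ico_of_mem_Ioo {θ : ℝ} (hθ : θ ∈ Ioo 0 π) : cos θ ∈ Ico (-1 : ℝ) 1 := by
  refine ⟨neg_one_le_cos θ, ?_⟩
  rw [← cos_zero]
  exact cos_lt_cos_of_nonneg_of_le_pi le_rfl hθ.2.le hθ.1

lemma innerJ_half_chebJ_eq_cosCoeff {f G : ℝ → ℝ} (hG : Continuous G)
    (hfG : EqOn f G (Ico (-1) 1)) (t : ℕ) :
    innerJ (1 / 2) (chebJ (1 / 2) t) f = cosCoeff G t - cosCoeff G (t + 2) := by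
  rw [innerJ_half_chebJ, cosCoeff, cosCoeff, ← mul_sub, ← intervalIntegral.integral_sub
    (intervalIntegrable_cos_mul_comp_cos hG _) (intervalIntegrable_cos_mul_comp_cos hG _)]
  congr 1
  refine intervalIntegral.integral_congr_uIoo fun θ hθ => ?_
  rw [uIoo_of_le pi_pos.le] at hθ
  simp only [hfG (cos_mem_Ico_of_mem_Ioo hθ)]
  push_cast
  ring

lemma innerJ_neg_half_chebJ_eq_cosCoeff {f G : ℝ → ℝ} (hG : Continuous G)
    (hfG : EqOn f G (Ico (-1) 1)) (t : ℕ) :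
    innerJ (-(1 / 2)) (chebJ (-(1 / 2)) t) f = cosCoeff G t + cosCoeff G (t + 1) := by
  rw [innerJ_neg_half_chebJ, cosCoeff, cosCoeff, ← mul_add, ← intervalIntegral.integral_add
    (intervalIntegrable_cos_mul_comp_cos hG _) (intervalIntegrable_cos_mul_comp_cos hG _)]
  congr 1
  refine intervalIntegral.integral_congr_uIoo fun θ hθ => ?_
  rw [uIoo_of_le pi_pos.le] at hθ
  simp only [hfG (cos_mem_Ico_of_mem_Ioo hθ)]
  push_cast
  ring

lemma cosCoeff_const_succ (c : ℝ) (k : ℕ) : cosCoeff (fun _ => c) (k + 1) = 0 := by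
  have hk : ((k + 1 : ℕ) : ℝ) ≠ 0 := by positivity
  rw [cosCoeff, intervalIntegral.integral_mul_const, intervalIntegral.integral_comp_mul_left _ hk,
    integral_cos, sin_nat_mul_pi]
  simp

lemma cosCoeff_sub_one_mul_add_const {G : ℝ → ℝ} (hG : Continuous G) (c : ℝ) (k : ℕ) :
    cosCoeff (fun x => (x - 1) * G x + c) (k + 1) =
      (cosCoeff G (k + 2) + cosCoeff G k) / 2 - cosCoeff G (k + 1) := by
  have hI := intervalIntegrable_cos_mul_comp_cos hG
  have hconst := cosCoeff_const_succ c k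
  have hc := intervalIntegrable_cos_mul_comp_cos (continuous_const (y := c)) (k + 1)
  have key : ∫ θ in (0 : ℝ)..π, cos ((k + 1 : ℕ) * θ) * ((cos θ - 1) * G (cos θ) + c) =
      (((∫ θ in (0 : ℝ)..π, cos ((k + 2 : ℕ) * θ) * G (cos θ)) +
        ∫ θ in (0 : ℝ)..π, cos (k * θ) * G (cos θ)) * (1 / 2) -
        ∫ θ in (0 : ℝ)..π, cos ((k + 1 : ℕ) * θ) * G (cos θ)) +
        ∫ θ in (0 : ℝ)..π, cos ((k + 1 : ℕ) * θ) * c := by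
    rw [← intervalIntegral.integral_add (hI _) (hI _), ← intervalIntegral.integral_mul_const,
      ← intervalIntegral.integral_sub (((hI _).add (hI _)).mul_const _) (hI _),
      ← intervalIntegral.integral_add ((((hI _).add (hI _)).mul_const _).sub (hI _)) hc]
    refine intervalIntegral.integral_congr fun θ _ => ?_
    have h₁ : ((k + 2 : ℕ) : ℝ) * θ = (k + 1 : ℕ) * θ + θ := by push_cast; ring
    have h₂ : (k : ℝ) * θ = (k + 1 : ℕ) * θ - θ := by push_cast; ring
    rw [h₁, h₂, cos_add, cos_sub]
    ring
  rw [cosCoeff] at hconst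
  rw [cosCoeff, key, mul_add, hconst, cosCoeff, cosCoeff, cosCoeff]
  ring

lemma summable_cosCoeff {G : ℝ → ℝ} (hG : ContDiff ℝ 2 G) : Summable (cosCoeff G) := by
  have hg : ContDiff ℝ 2 (fun θ => G (cos θ)) := hG.comp contDiff_cos
  set g : ℝ → ℝ := fun θ => G (cos θ)
  have hg₁ : ContDiff ℝ 1 (deriv g) :=
    ((contDiff_succ_iff_deriv (n := 1)).1 (by simpa [one_add_one_eq_two] using hg)).2.2
  have hg₂ : Continuous (deriv (deriv g)) := hg₁.continuous_deriv le_rfl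
  have hdg : Differentiable ℝ g := hg.differentiable (by norm_num)
  have hdg₁ : Differentiable ℝ (deriv g) := hg₁.differentiable (by norm_num)
  set C := |deriv g π| + |deriv g 0| + ∫ θ in (0 : ℝ)..π, |deriv (deriv g) θ|
  have hbound (k : ℕ) : ‖cosCoeff G (k + 1)‖ ≤ 1 / π * C * (1 / ((k + 1 : ℕ) : ℝ) ^ 2) := by
    set q : ℝ := ((k + 1 : ℕ) : ℝ) with hq
    have hq0 : 0 < q := by positivity
    have hderiv (θ : ℝ) : HasDerivAt
        (fun θ => sin (q * θ) / q * g θ + cos (q * θ) / q ^ 2 * deriv g θ)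
        (cos (q * θ) * g θ + cos (q * θ) * deriv (deriv g) θ * (1 / q ^ 2)) θ := by
      have hlin : HasDerivAt (fun θ => q * θ) q θ := by
        simpa using (hasDerivAt_id θ).const_mul q
      have h := ((hlin.sin.div_const q).mul (hdg θ).hasDerivAt).add
        ((hlin.cos.div_const (q ^ 2)).mul (hdg₁ θ).hasDerivAt)
      refine h.congr_deriv ?_
      field_simp
      ring
    have hcg : Continuous fun θ => cos (q * θ) * g θ := by
      have := hg.continuous
      fun_prop
    have hcg₂ : Continuous fun θ => cos (q * θ) * deriv (deriv g) θ := by fun_prop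
    have hcg₂' : Continuous fun θ => cos (q * θ) * deriv (deriv g) θ * (1 / q ^ 2) :=
      hcg₂.mul continuous_const
    have hFTC := intervalIntegral.integral_eq_sub_of_hasDerivAt (a := 0) (b := π)
      (fun θ _ => hderiv θ) ((hcg.add hcg₂').intervalIntegrable _ _)
    rw [intervalIntegral.integral_add (hcg.intervalIntegrable _ _)
      (hcg₂'.intervalIntegrable _ _),
      intervalIntegral.integral_mul_const, hq, sin_nat_mul_pi, ← hq, mul_zero, sin_zero,
      cos_zero] at hFTC
    have hI : |∫ θ in (0 : ℝ)..π, cos (q * θ) * deriv (deriv g) θ| ≤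
        ∫ θ in (0 : ℝ)..π, |deriv (deriv g) θ| := by
      refine (intervalIntegral.abs_integral_le_integral_abs pi_pos.le).trans ?_
      refine intervalIntegral.integral_mono_on pi_pos.le (hcg₂.abs.intervalIntegrable _ _)
        (hg₂.abs.intervalIntegrable _ _) fun θ _ => ?_
      rw [abs_mul]
      exact mul_le_of_le_one_left (abs_nonneg _) (abs_cos_le_one _)
    have hb : |cos (q * π) * deriv g π| ≤ |deriv g π| := by
      rw [abs_mul]
      exact mul_le_of_le_one_left (abs_nonneg _) (abs_cos_le_one _)
    have heq : ∫ θ in (0 : ℝ)..π, cos (q * θ) * g θ = (cos (q * π) * deriv g π - deriv g 0 -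
        ∫ θ in (0 : ℝ)..π, cos (q * θ) * deriv (deriv g) θ) * (1 / q ^ 2) := by
      linear_combination hFTC
    rw [cosCoeff, heq, norm_eq_abs, abs_mul, abs_mul, abs_of_pos (by positivity : 0 < 1 / π),
      abs_of_pos (by positivity : 0 < 1 / q ^ 2), mul_assoc]
    gcongr
    refine (abs_sub _ _).trans (add_le_add ((abs_sub _ _).trans (add_le_add hb le_rfl)) hI)
  have hs : Summable fun k : ℕ => 1 / π * C * (1 / ((k + 1 : ℕ) : ℝ) ^ 2) :=
    ((summable_nat_add_iff (f := fun k : ℕ => 1 / (k : ℝ) ^ 2) 1).2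
      (summable_one_div_nat_pow.2 one_lt_two)).mul_left _
  exact (summable_nat_add_iff 1).1 (Summable.of_norm_bounded hs hbound)

end CosineCoefficients

section TaylorRemainder

/-- The weighted average `∫₀¹ u^m G(1 + u (x - 1)) du` of `G` over the segment from `1` to `x`. -/
noncomputable def segmentAverage (m : ℕ) (G : ℝ → ℝ) (x : ℝ) : ℝ :=
  ∫ u in (0 : ℝ)..1, u ^ m * G (1 + u * (x - 1))

lemma hasDerivAt_segmentAverage {G : ℝ → ℝ} (hG : ContDiff ℝ 1 G) (m : ℕ) (x : ℝ) :
    HasDerivAt (segmentAverage m G) (segmentAverage (m + 1) (deriv G) x) x := by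
  have hGc := hG.continuous
  have hG' : Continuous (deriv G) := hG.continuous_deriv le_rfl
  have hcont : Continuous fun p : ℝ × ℝ => p.2 ^ (m + 1) * deriv G (1 + p.2 * (p.1 - 1)) := by
    fun_prop
  obtain ⟨C, hC⟩ := ((isCompact_closedBall x 1).prod (isCompact_Icc (a := (0 : ℝ)) (b := 1))
    ).exists_bound_of_continuousOn hcont.continuousOn
  refine (intervalIntegral.hasDerivAt_integral_of_dominated_loc_of_deriv_le
    (F' := fun x u => u ^ (m + 1) * deriv G (1 + u * (x - 1)))
    (bound := fun _ => C) (Metric.closedBall_mem_nhds x one_pos) ?_ ?_ ?_ ?_ ?_ ?_).2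
  · exact .of_forall fun y => Continuous.aestronglyMeasurable (by fun_prop)
  · exact Continuous.intervalIntegrable (by fun_prop) _ _
  · exact Continuous.aestronglyMeasurable (by fun_prop)
  · refine .of_forall fun u hu y hy => hC (y, u) ⟨hy, ?_⟩
    rw [uIoc_of_le zero_le_one] at hu
    exact ⟨hu.1.le, hu.2⟩
  · exact intervalIntegrable_const
  · refine .of_forall fun u _ y _ => ?_
    have hlin : HasDerivAt (fun y => 1 + u * (y - 1)) u y := by
      simpa using (((hasDerivAt_id y).sub_const 1).const_mul u).const_add 1
    have hd := (hG.differentiable (by norm_num) (1 + u * (y - 1))).hasDerivAt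
    refine ((hd.comp y hlin).const_mul (u ^ m)).congr_deriv ?_
    ring

lemma contDiff_segmentAverage {G : ℝ → ℝ} (hG : ContDiff ℝ (⊤ : ℕ∞) G) (m : ℕ) :
    ContDiff ℝ (⊤ : ℕ∞) (segmentAverage m G) := by
  rw [contDiff_infty]
  intro n
  induction n generalizing m G with
  | zero =>
    have h1 : ContDiff ℝ 1 G := hG.of_le (by exact_mod_cast le_top)
    exact contDiff_zero.2 (continuous_iff_continuousAt.2 fun x =>
      (hasDerivAt_segmentAverage h1 m x).continuousAt)
  | succ n ih =>
    have h1 : ContDiff ℝ 1 G := hG.of_le (by exact_mod_cast le_top)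
    have hd := hasDerivAt_segmentAverage h1 m
    push_cast
    rw [contDiff_succ_iff_deriv]
    refine ⟨fun x => (hd x).differentiableAt, by simp, ?_⟩
    rw [show deriv (segmentAverage m G) = segmentAverage (m + 1) (deriv G) from
      funext fun x => (hd x).deriv]
    exact ih (contDiff_infty_iff_deriv.1 hG).2 (m + 1)

lemma integral_pow_mul_eq_pow_mul_segmentAverage (m : ℕ) (G : ℝ → ℝ) (x : ℝ) :
    ∫ y in (1 : ℝ)..x, (y - 1) ^ m * G y = (x - 1) ^ (m + 1) * segmentAverage m G x := by
  have h := intervalIntegral.smul_integral_comp_add_mul (a := 0) (b := 1)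
    (f := fun y => (y - 1) ^ m * G y) (x - 1) 1
  rw [smul_eq_mul, mul_zero, add_zero, mul_one, add_sub_cancel] at h
  rw [← h, segmentAverage, ← intervalIntegral.integral_const_mul,
    ← intervalIntegral.integral_const_mul]
  refine intervalIntegral.integral_congr fun u _ => ?_
  simp only [add_sub_cancel_left, mul_pow, mul_comm u]
  ring

lemma hasDerivAt_taylorRem_succ {E : ℝ → ℝ} (hE : Differentiable ℝ E) (m : ℕ) (x : ℝ) :
    HasDerivAt (taylorRem E (m + 1 : ℕ)) (taylorRem (deriv E) m x) x := by
  have hterm (k : ℕ) : HasDerivAt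
      (fun x => iteratedDeriv (k + 1) E 1 / (k + 1).factorial * (x - 1) ^ (k + 1))
      (iteratedDeriv k (deriv E) 1 / k.factorial * (x - 1) ^ k) x := by
    have h := (((hasDerivAt_id x).sub_const 1).pow (k + 1)).const_mul
      (iteratedDeriv (k + 1) E 1 / (k + 1).factorial)
    refine h.congr_deriv ?_
    rw [iteratedDeriv_succ', Nat.factorial_succ]
    push_cast
    have : (k.factorial : ℝ) ≠ 0 := by positivity
    simp only [id, mul_one]
    field_simp
  have hsum := HasDerivAt.fun_sum (u := Finset.range m) fun k _ => hterm k
  have h := (hE x).hasDerivAt.sub (hsum.add_const (iteratedDeriv 0 E 1 / Nat.factorial 0 * 1))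
  refine (h.congr_deriv ?_).congr_of_eventuallyEq (.of_forall fun y => ?_)
  · simp [taylorRem]
  · simp only [taylorRem, Int.toNat_natCast, Finset.sum_range_succ', pow_zero, Pi.sub_apply]

lemma exists_contDiff_taylorRem_eq {E : ℝ → ℝ} (hE : ContDiff ℝ (⊤ : ℕ∞) E) (m : ℕ) :
    ∃ G : ℝ → ℝ, ContDiff ℝ (⊤ : ℕ∞) G ∧ ∀ x, taylorRem E m x = (x - 1) ^ m * G x := by
  induction m generalizing E with
  | zero => exact ⟨E, hE, fun x => by simp [taylorRem]⟩
  | succ m ih =>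
    obtain ⟨hdiff, hderiv⟩ := contDiff_infty_iff_deriv.1 hE
    obtain ⟨G, hG, hrem⟩ := ih hderiv
    refine ⟨segmentAverage m G, contDiff_segmentAverage hG m, fun x => ?_⟩
    have hGc := hG.continuous
    have hFTC := intervalIntegral.integral_eq_sub_of_hasDerivAt (a := 1) (b := x)
      (fun y _ => (hrem y) ▸ hasDerivAt_taylorRem_succ hdiff m y)
      (Continuous.intervalIntegrable (by fun_prop) _ _)
    have h1 : taylorRem E (m + 1 : ℕ) 1 = 0 := by
      simp [taylorRem, Finset.sum_range_succ']
    rw [h1, sub_zero] at hFTC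
    rw [← hFTC, integral_pow_mul_eq_pow_mul_segmentAverage]

lemma exists_contDiff_eventuallyEq {E : ℝ → ℝ} {U : Set ℝ} (hU : IsOpen U)
    (hsub : Icc (-1 : ℝ) 1 ⊆ U) (hE : ContDiffOn ℝ (⊤ : ℕ∞) E U) :
    ∃ F : ℝ → ℝ, ContDiff ℝ (⊤ : ℕ∞) F ∧ ∀ x ∈ Icc (-1 : ℝ) 1, E =ᶠ[𝓝 x] F := by
  obtain ⟨δ, hδ, hthick⟩ := isCompact_Icc.exists_cthickening_subset_open hU hsub
  have hball : Metric.closedBall (0 : ℝ) (1 + δ) ⊆ U := by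
    refine subset_trans (fun x hx => ?_) hthick
    rw [show Icc (-1 : ℝ) 1 = Metric.closedBall 0 1 by simp [closedBall_eq_Icc],
      cthickening_closedBall hδ.le zero_le_one]
    rwa [add_comm]
  let χ : ContDiffBump (0 : ℝ) := ⟨1 + δ / 3, 1 + δ / 2, by positivity, by linarith⟩
  refine ⟨fun x => χ x * E x, contDiff_iff_contDiffAt.2 fun x => ?_, fun x hx => ?_⟩
  · by_cases hx : x ∈ Metric.closedBall (0 : ℝ) (1 + δ / 2)
    · exact χ.contDiffAt.mul (hE.contDiffAt (hU.mem_nhds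
        (hball (Metric.closedBall_subset_closedBall (by linarith) hx))))
    · refine (contDiffAt_const (c := (0 : ℝ))).congr_of_eventuallyEq ?_
      filter_upwards [Metric.isClosed_closedBall.isOpen_compl.mem_nhds hx] with y hy
      have : χ y = 0 := χ.zero_of_le_dist (by
        simp only [mem_compl_iff, Metric.mem_closedBall, not_le] at hy
        exact hy.le)
      rw [this, zero_mul]
  · have hmem : x ∈ Metric.ball (0 : ℝ) (1 + δ / 3) := by
      rw [mem_ball_zero_iff, norm_eq_abs]
      linarith [abs_le.2 hx]
    filter_upwards [Metric.isOpen_ball.mem_nhds hmem] with y hy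
    have : χ y = 1 := χ.one_of_mem_closedBall (Metric.ball_subset_closedBall hy)
    rw [this, one_mul]

lemma exists_contDiff_eqOn_powRem {E : ℝ → ℝ} {U : Set ℝ} (hU : IsOpen U)
    (hsub : Icc (-1 : ℝ) 1 ⊆ U) (hE : ContDiffOn ℝ (⊤ : ℕ∞) E U) (m : ℤ) :
    ∃ G : ℝ → ℝ, ContDiff ℝ (⊤ : ℕ∞) G ∧ EqOn (powRem E m) G (Ico (-1) 1) := by
  obtain ⟨F, hF, hEF⟩ := exists_contDiff_eventuallyEq hU hsub hE
  by_cases hm : 0 < m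
  · lift m to ℕ using hm.le
    obtain ⟨G, hG, hrem⟩ := exists_contDiff_taylorRem_eq hF m
    refine ⟨G, hG, fun x hx => ?_⟩
    have hx1 : (x - 1) ^ m ≠ 0 := pow_ne_zero _ (sub_ne_zero.2 hx.2.ne)
    have hEq : taylorRem E m x = taylorRem F m x := by
      simp only [taylorRem, (hEF x ⟨hx.1, hx.2.le⟩).eq_of_nhds,
        (hEF 1 ⟨by norm_num, le_rfl⟩).iteratedDeriv_eq]
    rw [powRem, if_pos hm, if_neg hx.2.ne, hEq, hrem, Int.toNat_natCast, mul_div_cancel_left₀ _ hx1]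
  · refine ⟨fun x => (x - 1) ^ (-m).toNat * F x, by fun_prop, fun x hx => ?_⟩
    rw [powRem, if_neg hm, (hEF x ⟨hx.1, hx.2.le⟩).eq_of_nhds]

lemma exists_powRem_eq_sub_one_mul_add (E : ℝ → ℝ) (m : ℤ) :
    ∃ c : ℝ, ∀ x : ℝ, x ≠ 1 → powRem E m x = (x - 1) * powRem E (m + 1) x + c := by
  rcases lt_trichotomy m 0 with hm | rfl | hm
  · refine ⟨0, fun x _ => ?_⟩
    rw [powRem, powRem, if_neg (by omega), if_neg (by omega),
      show (-m).toNat = (-(m + 1)).toNat + 1 by omega]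
    ring
  · refine ⟨E 1, fun x hx => ?_⟩
    have := sub_ne_zero.2 hx
    simp [powRem, hx, taylorRem]
    field_simp
    ring
  · lift m to ℕ using hm.le
    refine ⟨iteratedDeriv m E 1 / m.factorial, fun x hx => ?_⟩
    have := sub_ne_zero.2 hx
    rw [powRem, powRem, if_pos hm, if_pos (hm.trans (lt_add_one _)), if_neg hx, if_neg hx, taylorRem, taylorRem,
      show ((m : ℤ) + 1).toNat = m + 1 by omega, Int.toNat_natCast, Finset.sum_range_succ]
    field_simp
    ring

end TaylorRemainder

section Summation

lemma hasSum_ite_le_of_hasSum_add {f : ℕ → ℝ} {S : ℝ} {s : ℕ}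
    (h : HasSum (fun t => f (t + s)) S) : HasSum (fun t => if s ≤ t then f t else 0) S := by
  rw [← hasSum_nat_add_iff' s, Finset.sum_eq_zero fun t ht => if_neg (by simpa using ht), sub_zero]
  simpa using h

lemma Summable.hasSum_sub_add_two {a : ℕ → ℝ} (ha : Summable a) (s : ℕ) :
    HasSum (fun t => a (t + s) - a (t + s + 2)) (a s + a (s + 1)) := by
  have h := ((summable_nat_add_iff s).2 ha).hasSum
  have h2 := h.sub ((hasSum_nat_add_iff' 2).2 h)
  simpa [Finset.sum_range_succ, add_right_comm, add_comm 1 s] using h2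

lemma Summable.hasSum_sub_succ {a : ℕ → ℝ} (ha : Summable a) (s : ℕ) :
    HasSum (fun t => a (t + s) - a (t + s + 1)) (a s) := by
  have h := ((summable_nat_add_iff s).2 ha).hasSum
  have h2 := h.sub ((hasSum_nat_add_iff' 1).2 h)
  simpa [add_right_comm] using h2

end Summation

/-- Composition rule: `∑_{t≥0} φ_{n−1}(s,t)·Ψ^n_{r_n−l}(t) = Ψ^{n−1}_{r_{n−1}−l}(s)`. -/
theorem psi_composition_rule (E : ℝ → ℝ) (U : Set ℝ) (hU : IsOpen U)
    (hsub : Set.Icc (-1 : ℝ) 1 ⊆ U) (hE : ContDiffOn ℝ (⊤ : ℕ∞) E U)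
    (n : ℕ) (hn : 2 ≤ n) (l : ℤ) (s : ℕ) :
    HasSum (fun t : ℕ => phiStep (n - 1) s t * PsiFn E n l t)
      (PsiFn E (n - 1) l s) := by
  obtain ⟨k, rfl⟩ : ∃ k, n = k + 1 := ⟨n - 1, by omega⟩
  simp only [add_tsub_cancel_right]
  rcases Nat.even_or_odd k with hk | hk
  · have hk' : ¬ Even (k + 1) := by simpa [Nat.even_add_one] using hk
    have hrr : l - (rr k : ℤ) = l - (rr (k + 1) : ℤ) + 1 := by
      obtain ⟨j, rfl⟩ := hk
      simp only [rr]
      omega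
    simp only [phiStep, PsiFn, alph, if_pos hk, if_neg hk', hrr]
    set m := l - (rr (k + 1) : ℤ)
    obtain ⟨G, hG, hGeq⟩ := exists_contDiff_eqOn_powRem hU hsub hE (m + 1)
    obtain ⟨c, hc⟩ := exists_powRem_eq_sub_one_mul_add E m
    have hGc := hG.continuous
    have hsum : Summable (cosCoeff G) :=
      summable_cosCoeff (contDiff_infty.1 hG 2)
    have hEq : EqOn (powRem E m) (fun x => (x - 1) * G x + c) (Ico (-1) 1) := fun x hx => by
      simp only [hc x hx.2.ne, hGeq hx]
    rw [innerJ_half_chebJ_eq_cosCoeff hGc hGeq]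
    simp only [innerJ_neg_half_chebJ_eq_cosCoeff (by fun_prop) hEq, ite_mul, zero_mul]
    refine hasSum_ite_le_of_hasSum_add (s := s + 1) (f := fun t => 2 *
      (cosCoeff (fun x => (x - 1) * G x + c) t +
        cosCoeff (fun x => (x - 1) * G x + c) (t + 1))) ?_
    refine ((hsum.hasSum_sub_succ s).sub (hsum.hasSum_sub_succ (s + 2))).congr_fun fun t => ?_
    simp only [← add_assoc, cosCoeff_sub_one_mul_add_const hGc]
    ring
  · have hk' : Even (k + 1) := hk.add_one
    have hk0 := Nat.not_even_iff_odd.2 hk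
    have hrr : rr k = rr (k + 1) := by
      obtain ⟨j, rfl⟩ := hk
      simp only [rr]
      omega
    simp only [phiStep, PsiFn, alph, if_neg hk0, if_pos hk', hrr]
    obtain ⟨G, hG, hGeq⟩ := exists_contDiff_eqOn_powRem hU hsub hE (l - (rr (k + 1) : ℤ))
    have hGc := hG.continuous
    have hsum : Summable (cosCoeff G) :=
      summable_cosCoeff (contDiff_infty.1 hG 2)
    simp only [innerJ_neg_half_chebJ_eq_cosCoeff hGc hGeq,
      innerJ_half_chebJ_eq_cosCoeff hGc hGeq, ite_mul, zero_mul, one_mul]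
    exact hasSum_ite_le_of_hasSum_add (f := fun t => cosCoeff G t - cosCoeff G (t + 2))
      (hsum.hasSum_sub_add_two s)
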